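/- Let c : ℝⁿ → ℝ and h : ℝⁿ → ℝᵐ be twice continuously differentiable and let μ > 0 and m > 0. Define v(x,λ) = ∇c(x) + (Dh(x))*λ + μ (Dh(x))*(h(x)). Suppose x : ℝ → ℝⁿ and λ : ℝ → ℝᵐ are differentiable curves satisfying x′(t) = −v(x(t), λ(t)) and λ′(t) = μ h(x(t)), and suppose that for every t ≥ 0 the Fréchet derivative A(t) of y ↦ v(y, λ(t)) at x(t) satisfies ⟨w, A(t) w⟩ ≥ m‖w‖² for all w ∈ ℝⁿ. Then for every T ≥ 0, ∫₀ᵀ ‖v(x(t),λ(t))‖² dt ≤ E(0)/m, where E(t) = (1/2)‖v(x(t),λ(t))‖² + (μ/2)‖h(x(t))‖². -/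

import Mathlib

open RealInnerProductSpace

/-- The gradient of a `C^2` function on a Hilbert space is differentiable. -/
theorem ContDiff.differentiable_gradient {F : Type*} [NormedAddCommGroup F]
    [InnerProductSpace ℝ F] [CompleteSpace F] {c : F → ℝ} (hc : ContDiff ℝ 2 c) :
    Differentiable ℝ (gradient c) :=
  (InnerProductSpace.toDual ℝ F).symm.toContinuousLinearEquiv.differentiable.comp
    ((hc.fderiv_right (m := 1) (by norm_num)).differentiable (by norm_num))

/-- The adjoint of the derivative of a `C^2` map between Hilbert spaces is differentiable. -/
theorem ContDiff.differentiable_adjoint_fderiv {F G : Type*}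
    [NormedAddCommGroup F] [InnerProductSpace ℝ F] [CompleteSpace F]
    [NormedAddCommGroup G] [InnerProductSpace ℝ G] [CompleteSpace G]
    {h : F → G} (hh : ContDiff ℝ 2 h) :
    Differentiable ℝ fun y => (fderiv ℝ h y).adjoint :=
  (ContinuousLinearMap.adjoint (𝕜 := ℝ) (E := F)
    (F := G)).toContinuousLinearEquiv.differentiable.comp
    ((hh.fderiv_right (m := 1) (by norm_num)).differentiable (by norm_num))

/-- Quantitative dissipation estimate: along the zero-noise flow `x' = -v(x,λ)`,
`λ' = μ h(x)` on `[0, ∞)` with `v(x,λ) = ∇c x + (Dh x)* λ + μ (Dh x)* (h x)`, if the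
Fréchet derivative `A(t)` of `y ↦ v(y, λ(t))` at `x(t)` satisfies
`⟪w, A(t) w⟫ ≥ m‖w‖²` for all `t ≥ 0`, then `∫₀ᵀ ‖v‖² dt ≤ E(0)/m` for all `T ≥ 0`,
where `E = (1/2)‖v‖² + (μ/2)‖h‖²`. -/
theorem stmt_11 (n mdim : ℕ) (c : EuclideanSpace ℝ (Fin n) → ℝ)
    (h : EuclideanSpace ℝ (Fin n) → EuclideanSpace ℝ (Fin mdim))
    (μ : ℝ) (hμ : 0 < μ) (m : ℝ) (hm : 0 < m)
    (hc : ContDiff ℝ 2 c) (hh : ContDiff ℝ 2 h)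
    (v : EuclideanSpace ℝ (Fin n) → EuclideanSpace ℝ (Fin mdim) → EuclideanSpace ℝ (Fin n))
    (hv : ∀ y l, v y l =
      gradient c y + (fderiv ℝ h y).adjoint l + μ • (fderiv ℝ h y).adjoint (h y))
    (x : ℝ → EuclideanSpace ℝ (Fin n)) (lam : ℝ → EuclideanSpace ℝ (Fin mdim))
    (hx : ∀ t, 0 ≤ t → HasDerivAt x (-(v (x t) (lam t))) t)
    (hlam : ∀ t, 0 ≤ t → HasDerivAt lam (μ • h (x t)) t)
    (hA : ∀ t, 0 ≤ t → ∀ w : EuclideanSpace ℝ (Fin n),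
      m * ‖w‖ ^ 2 ≤ ⟪w, (fderiv ℝ (fun y => v y (lam t)) (x t)) w⟫)
    (E : ℝ → ℝ)
    (hE : ∀ t, E t = (1 / 2) * ‖v (x t) (lam t)‖ ^ 2 + (μ / 2) * ‖h (x t)‖ ^ 2) :
    ∀ T : ℝ, 0 ≤ T → ∫ t in (0 : ℝ)..T, ‖v (x t) (lam t)‖ ^ 2 ≤ E 0 / m := by
  have hadj := hh.differentiable_adjoint_fderiv
  have hhd : Differentiable ℝ h := hh.differentiable (by norm_num)
  have hvd (l) : Differentiable ℝ fun y => v y l := by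
    simp only [hv]
    exact (hc.differentiable_gradient.add (hadj.clm_apply (differentiable_const l))).add
      ((hadj.clm_apply hhd).const_smul μ)
  have hvt (s : ℝ) (hs : 0 ≤ s) : HasDerivAt (fun t => v (x t) (lam t))
      (-(fderiv ℝ (fun y => v y (lam s)) (x s) (v (x s) (lam s)))
        + μ • (fderiv ℝ h (x s)).adjoint (h (x s))) s := by
    have h₁ := ((hvd (lam s)) (x s)).hasFDerivAt.comp_hasDerivAt s (hx s hs)
    have h₂ := ((hadj (x s)).hasFDerivAt.comp_hasDerivAt s (hx s hs)).clm_apply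
      ((hlam s hs).sub_const (lam s))
    have hsum := h₁.add h₂
    simp only [sub_self, map_zero, zero_add, map_neg, map_smul, Function.comp_apply] at hsum
    refine hsum.congr_of_eventuallyEq (Filter.Eventually.of_forall fun t => ?_)
    simp only [Pi.add_apply, Function.comp_apply, hv, map_sub]
    abel
  have hEt (s : ℝ) (hs : 0 ≤ s) : HasDerivAt E
      (-⟪v (x s) (lam s), fderiv ℝ (fun y => v y (lam s)) (x s) (v (x s) (lam s))⟫) s := by
    have h₁ := (hvt s hs).norm_sq.const_mul (1 / 2)
    have h₂ := ((hhd (x s)).hasFDerivAt.comp_hasDerivAt s (hx s hs)).norm_sq.const_mul (μ / 2)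
    rw [funext hE]
    refine (h₁.add h₂).congr_deriv ?_
    simp only [Function.comp_apply, inner_add_right, inner_neg_right, map_neg, inner_smul_right,
      ContinuousLinearMap.adjoint_inner_right]
    rw [real_inner_comm (h (x s))]
    ring
  intro T hT
  have hint : MeasureTheory.IntegrableOn (fun t => m * ‖v (x t) (lam t)‖ ^ 2) (Set.Icc 0 T) :=
    ContinuousOn.integrableOn_Icc fun t ht =>
      ((hvt t ht.1).norm_sq.const_mul m).continuousAt.continuousWithinAt
  have hle := intervalIntegral.integral_le_sub_of_hasDeriv_right_of_le hT
    (fun t ht => (hEt t ht.1).neg.continuousAt.continuousWithinAt)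
    (fun t ht => (hEt t ht.1.le).neg.hasDerivWithinAt) hint
    (fun t ht => by simpa using hA t ht.1.le (v (x t) (lam t)))
  have hET : 0 ≤ E T := by rw [hE]; positivity
  rw [intervalIntegral.integral_const_mul] at hle
  simp only [Pi.neg_apply] at hle
  rw [le_div_iff₀ hm]
  linarith
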